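/- Let R₀ > 0, θ ∈ [0,1], δ₁ ∈ (0,1/2], and let g : ℝ → ℝ be a smooth function with 0 ≤ g ≤ 1, g(t) = 0 for t ≤ 0, and g(t) = 1 for t ≥ δ₁/2. For R > 0 define φ^R : ℝ² → ℝ by φ^R(x) = g(R^{−θ}(R − |x|)). Let ω : ℝ² → ℝ be continuous with support contained in B(0,R₀), set m = ∫_{ℝ²} ω, let u(x) = (1/(2π)) ∫_{ℝ²} ((x−y)^⊥/|x−y|²) ω(y) dy, let ψ_R(x) = (1/(2π)) ∫_{ℝ²} log|x−y| ω(y) dy − (m/(2π)) log R, and let T_R u = ∇^⊥(φ^R ψ_R). Then there exists a constant C > 0, depending only on R₀, θ, δ₁ and g, such that for every R ≥ max(4R₀, 1) and every x ∈ B(0,R): |(T_R u)(x)| ≤ sup_{y ∈ ℝ²} |u(y)| + C ‖ω‖_{L¹(ℝ²)} R^{−1}. -/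

import Mathlib

open MeasureTheory Real

/-- The perpendicular `z^⊥ = (-z₂, z₁)` of a vector in `ℝ²`. -/
noncomputable def perp (z : EuclideanSpace ℝ (Fin 2)) : EuclideanSpace ℝ (Fin 2) :=
  (EuclideanSpace.equiv (Fin 2) ℝ).symm ![-z 1, z 0]

/-- The perpendicular gradient `∇^⊥ f = (−∂₂f, ∂₁f)` of a scalar function on `ℝ²`. -/
noncomputable def perpGrad (f : EuclideanSpace ℝ (Fin 2) → ℝ)
    (x : EuclideanSpace ℝ (Fin 2)) : EuclideanSpace ℝ (Fin 2) :=
  (EuclideanSpace.equiv (Fin 2) ℝ).symm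
    ![-(fderiv ℝ f x (EuclideanSpace.single 1 1)),
      fderiv ℝ f x (EuclideanSpace.single 0 1)]

/-- The two-dimensional Biot–Savart law
`u(x) = (1/(2π)) ∫ ((x−y)^⊥/|x−y|²) ω(y) dy`. -/
noncomputable def biotSavart2D (ω : EuclideanSpace ℝ (Fin 2) → ℝ)
    (x : EuclideanSpace ℝ (Fin 2)) : EuclideanSpace ℝ (Fin 2) :=
  (1 / (2 * π)) • ∫ y, (ω y / ‖x - y‖ ^ 2) • perp (x - y)

/-- The stream function of `ω` normalized so that it vanishes at `|x| = R`
when `ω` is radial: `ψ_R(x) = (1/(2π)) ∫ log|x−y| ω(y) dy − (m/(2π)) log R`. -/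
noncomputable def streamR (ω : EuclideanSpace ℝ (Fin 2) → ℝ) (m R : ℝ)
    (x : EuclideanSpace ℝ (Fin 2)) : ℝ :=
  (1 / (2 * π)) * (∫ y, Real.log ‖x - y‖ * ω y) - (m / (2 * π)) * Real.log R

/-- The boundary-layer cutoff `φ^R(x) = g(R^{−θ}(R − |x|))`. -/
noncomputable def cutoff (g : ℝ → ℝ) (θ R : ℝ) (x : EuclideanSpace ℝ (Fin 2)) : ℝ :=
  g (R ^ (-θ) * (R - ‖x‖))

/-- The truncation operator `T_R u = ∇^⊥(φ^R ψ_R)`. -/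
noncomputable def truncate (g : ℝ → ℝ) (θ R : ℝ) (ω : EuclideanSpace ℝ (Fin 2) → ℝ)
    (m : ℝ) : EuclideanSpace ℝ (Fin 2) → EuclideanSpace ℝ (Fin 2) :=
  perpGrad (fun x => cutoff g θ R x * streamR ω m R x)

section trunc_helpers
open Filter Topology

abbrev E2 := EuclideanSpace ℝ (Fin 2)

noncomputable def qk (z : E2) : ℝ := (Set.Iic (1:ℝ)).indicator (fun r => r⁻¹) ‖z‖

lemma qk_nonneg (z : E2) : 0 ≤ qk z := by
  unfold qk; apply Set.indicator_apply_nonneg; intro _; positivity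

lemma qk_integrable : Integrable qk := by
  have h := (integrable_fun_norm_addHaar (E := E2) (F := ℝ) volume
    (f := (Set.Iic (1:ℝ)).indicator (fun r => r⁻¹)))
  refine h.2 ?_
  have h1 : IntegrableOn ((Set.Ioc (0:ℝ) 1).indicator (fun _ => (1:ℝ))) (Set.Ioi 0) := by
    apply Integrable.integrableOn
    rw [integrable_indicator_iff measurableSet_Ioc]
    simp
  refine h1.congr_fun ?_ measurableSet_Ioi
  intro r hr
  have hr : 0 < r := hr
  by_cases h2 : r ≤ 1 <;> simp [Set.indicator, hr, h2, hr.ne']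

lemma inv_le_qk (z : E2) : ‖z‖⁻¹ ≤ 1 + qk z := by
  unfold qk
  by_cases h : ‖z‖ ≤ 1
  · simp [Set.indicator, h]
  · simp only [Set.indicator, Set.mem_Iic, h, if_false, add_zero]
    push Not at h
    exact inv_le_one_of_one_le₀ h.le

lemma qk_sub_integrable (x : E2) : Integrable (fun y => qk (x - y)) :=
  qk_integrable.comp_sub_left x

lemma om_bound {ω : E2 → ℝ} (hc : Continuous ω) (hs : HasCompactSupport ω) :
    ∃ M, 0 ≤ M ∧ ∀ y, |ω y| ≤ M := by
  obtain ⟨M, hM⟩ := hs.exists_bound_of_continuous hc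
  exact ⟨M, (norm_nonneg _).trans (hM 0), hM⟩

/-- dominating function -/
lemma dom_integrable {ω : E2 → ℝ} (hc : Continuous ω) (hs : HasCompactSupport ω) (M : ℝ) (x : E2) :
    Integrable (fun y => |ω y| + M * qk (x - y)) :=
  (hc.integrable_of_hasCompactSupport hs).abs.add ((qk_sub_integrable x).const_mul M)

lemma inv_mul_le {ω : E2 → ℝ} {M : ℝ} (hM : ∀ y, |ω y| ≤ M) (x y : E2) :
    |ω y| * ‖x - y‖⁻¹ ≤ |ω y| + M * qk (x - y) := by
  have h1 := inv_le_qk (x - y)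
  have h2 := mul_le_mul_of_nonneg_left h1 (abs_nonneg (ω y))
  have h3 := mul_le_mul_of_nonneg_right (hM y) (qk_nonneg (x - y))
  linarith

lemma norm_kern {ω : E2 → ℝ} (x y : E2) :
    ‖(ω y / ‖x - y‖ ^ 2) • (x - y)‖ = |ω y| * ‖x - y‖⁻¹ := by
  rw [norm_smul, norm_div, norm_pow, norm_norm, Real.norm_eq_abs]
  by_cases h : ‖x - y‖ = 0
  · simp [h]
  · field_simp

lemma vint {ω : E2 → ℝ} (hc : Continuous ω) (hs : HasCompactSupport ω) (x : E2) :
    Integrable (fun y => (ω y / ‖x - y‖ ^ 2) • (x - y)) := by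
  obtain ⟨M, hM0, hM⟩ := om_bound hc hs
  refine (dom_integrable hc hs M x).mono' ?_ (Eventually.of_forall fun y => ?_)
  · have := hc.measurable
    exact (by fun_prop : Measurable _).aestronglyMeasurable
  · rw [norm_kern]; exact inv_mul_le hM x y

lemma logint {ω : E2 → ℝ} (hc : Continuous ω) (hs : HasCompactSupport ω) (x : E2) :
    Integrable (fun y => Real.log ‖x - y‖ * ω y) := by
  obtain ⟨M, hM0, hM⟩ := om_bound hc hs
  have h1 : Integrable (fun y => ‖x - y‖ * |ω y|) := by
    apply Continuous.integrable_of_hasCompactSupport (by fun_prop)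
    exact (hs.comp_left (g := fun t : ℝ => |t|) abs_zero).mul_left
  refine (h1.add (dom_integrable hc hs M x)).mono' ?_ (Eventually.of_forall fun y => ?_)
  · have := hc.measurable
    exact (by fun_prop : Measurable _).aestronglyMeasurable
  · have h2 : |Real.log ‖x - y‖| ≤ ‖x - y‖ + ‖x - y‖⁻¹ := by
      rcases eq_or_lt_of_le (norm_nonneg (x - y)) with h | h
      · rw [← h]; simp
      · have a := Real.log_le_sub_one_of_pos h
        have b := Real.log_le_sub_one_of_pos (inv_pos.2 h)
        rw [Real.log_inv] at b
        have := inv_pos.2 h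
        rw [abs_le]; constructor <;> linarith
    have h3 := inv_mul_le hM x y
    have h4 := mul_le_mul_of_nonneg_right h2 (abs_nonneg (ω y))
    simp only [Pi.add_apply]
    rw [norm_mul, Real.norm_eq_abs, Real.norm_eq_abs]
    linarith

noncomputable def kf (e : ℝ) (z : E2) : ℝ := (1/2) * Real.log (‖z‖^2 + e^2)

noncomputable def kd (e : ℝ) (z : E2) : E2 := (‖z‖^2 + e^2)⁻¹ • z

lemma kf_deriv {e : ℝ} (he : 0 < e) (z : E2) : HasFDerivAt (kf e) (innerSL ℝ (kd e z)) z := by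
  have h1 : HasFDerivAt (fun z : E2 => ‖z‖^2 + e^2) (2 • innerSL ℝ z) z :=
    (hasStrictFDerivAt_norm_sq z).hasFDerivAt.add_const _
  have h2 := (h1.log (by positivity)).const_mul (1/2)
  refine h2.congr_fderiv ?_
  ext w
  simp [kd]
  ring

lemma kd_norm {e : ℝ} (he : 0 < e) (z : E2) : ‖kd e z‖ ≤ e⁻¹ := by
  unfold kd
  rw [norm_smul, norm_inv, Real.norm_of_nonneg (by positivity), inv_mul_le_iff₀ (by positivity)]
  rw [← div_eq_mul_inv, le_div_iff₀ he]
  nlinarith [sq_nonneg (‖z‖ - e), sq_nonneg ‖z‖, norm_nonneg z]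

lemma kf_cont {e : ℝ} (he : 0 < e) : Continuous (kf e) := by
  unfold kf
  exact continuous_const.mul (Continuous.log (by fun_prop) (fun z => by positivity))

lemma kd_cont {e : ℝ} (he : 0 < e) : Continuous (kd e) := by
  unfold kd
  exact Continuous.smul (Continuous.inv₀ (by fun_prop : Continuous fun z : E2 => ‖z‖^2 + e^2)
    (fun z => by positivity)) continuous_id

lemma reg_deriv {ω : E2 → ℝ} (hc : Continuous ω) (hs : HasCompactSupport ω) {e : ℝ} (he : 0 < e)
    (x : E2) : HasFDerivAt (fun x => ∫ y, kf e (x - y) * ω y)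
      (∫ y, ω y • innerSL ℝ (kd e (x - y))) x := by
  have kc := kf_cont he
  have dc := kd_cont he
  refine hasFDerivAt_integral_of_dominated_of_fderiv_le (𝕜 := ℝ) (s := Set.univ)
    (F := fun x y => kf e (x - y) * ω y) (F' := fun x y => ω y • innerSL ℝ (kd e (x - y)))
    (bound := fun y => e⁻¹ * |ω y|) univ_mem ?_ ?_ ?_ ?_ ?_ ?_
  · exact Eventually.of_forall fun x => Continuous.aestronglyMeasurable (by fun_prop)
  · exact Continuous.integrable_of_hasCompactSupport (by fun_prop) hs.mul_left
  · exact Continuous.aestronglyMeasurable (by fun_prop)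
  · refine Eventually.of_forall fun y x _ => ?_
    rw [norm_smul, innerSL_apply_norm, Real.norm_eq_abs, mul_comm]
    exact mul_le_mul_of_nonneg_right (kd_norm he _) (abs_nonneg _)
  · exact (hc.integrable_of_hasCompactSupport hs).abs.const_mul _
  · refine Eventually.of_forall fun y x _ => ?_
    have h := (kf_deriv he (x - y)).comp x ((hasFDerivAt_id x).sub_const y)
    have h2 := h.mul_const (ω y)
    refine h2.congr_fderiv ?_
    ext w; simp

noncomputable def qe (e : ℝ) (z : E2) : ℝ := qk z * (e^2 / (‖z‖^2 + e^2))

lemma qe_nonneg (e : ℝ) (z : E2) : 0 ≤ qe e z := mul_nonneg (qk_nonneg z) (by positivity)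

lemma qk_meas : Measurable qk := by
  unfold qk
  exact (Measurable.indicator (by fun_prop) measurableSet_Iic).comp measurable_norm

lemma qe_le (e : ℝ) (z : E2) : qe e z ≤ qk z := by
  unfold qe
  refine mul_le_of_le_one_right (qk_nonneg z) ?_
  apply div_le_one_of_le₀ <;> nlinarith [sq_nonneg ‖z‖, sq_nonneg e]

lemma qe_integrable (e : ℝ) : Integrable (qe e) := by
  refine qk_integrable.mono' ?_ (Eventually.of_forall fun z => ?_)
  · have := qk_meas
    unfold qe
    exact (by fun_prop : Measurable _).aestronglyMeasurable
  · rw [Real.norm_of_nonneg (qe_nonneg e z)]; exact qe_le e z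

lemma qe_tendsto {e : ℕ → ℝ} (h0 : Tendsto e atTop (𝓝 0)) :
    Tendsto (fun n => ∫ z, qe (e n) z) atTop (𝓝 0) := by
  have : Tendsto (fun n => ∫ z, qe (e n) z) atTop (𝓝 (∫ z : E2, (0:ℝ))) := by
    refine tendsto_integral_of_dominated_convergence qk ?_ qk_integrable ?_ ?_
    · exact fun n => (qe_integrable _).aestronglyMeasurable
    · exact fun n => Eventually.of_forall fun z => by
        rw [Real.norm_of_nonneg (qe_nonneg _ z)]; exact qe_le _ z
    · refine Eventually.of_forall fun z => ?_
      by_cases hz : z = 0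
      · simp [qe, qk, hz, Set.indicator]
      · have hz' : ‖z‖^2 + 0^2 ≠ 0 := by simpa using hz
        have := ((h0.pow 2).div ((h0.pow 2).const_add (‖z‖^2)) hz').const_mul (qk z)
        simpa [qe] using this
  simpa using this

lemma diff_bound {ω : E2 → ℝ} {M : ℝ} (hM : ∀ y, |ω y| ≤ M) {e : ℝ} (he : 0 < e) (x y : E2) :
    ‖(ω y / ‖x - y‖ ^ 2) • (x - y) - ω y • kd e (x - y)‖ ≤ e^2 * |ω y| + M * qe e (x - y) := by
  set z := x - y with hz
  have hM0 : 0 ≤ M := (abs_nonneg _).trans (hM y)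
  by_cases h0 : z = 0
  · simp only [h0, kd, smul_zero, sub_zero, norm_zero]
    have := qe_nonneg e (0 : E2)
    positivity
  have hn : 0 < ‖z‖ := norm_pos_iff.2 h0
  have h1 : (ω y / ‖z‖ ^ 2) • z - ω y • kd e z
      = (ω y * (e^2 / (‖z‖^2 * (‖z‖^2 + e^2)))) • z := by
    unfold kd
    rw [smul_smul, ← sub_smul]
    congr 1
    field_simp
    ring
  rw [h1, norm_smul, norm_mul, Real.norm_eq_abs, Real.norm_of_nonneg (by positivity)]
  have h2 : |ω y| * (e^2 / (‖z‖^2 * (‖z‖^2 + e^2))) * ‖z‖ =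
     |ω y| * (‖z‖⁻¹ * (e^2 / (‖z‖^2 + e^2))) := by field_simp
  rw [h2]
  have hq := qe_nonneg e z
  by_cases h : ‖z‖ ≤ 1
  · have : qe e z = ‖z‖⁻¹ * (e^2 / (‖z‖^2 + e^2)) := by
      simp [qe, qk, Set.indicator, h]
    rw [← this]
    have := mul_le_mul_of_nonneg_right (hM y) hq
    have : 0 ≤ e^2 * |ω y| := by positivity
    linarith
  · push Not at h
    have a : ‖z‖⁻¹ ≤ 1 := inv_le_one_of_one_le₀ h.le
    have b : e^2 / (‖z‖^2 + e^2) ≤ e^2 := div_le_self (by positivity) (by nlinarith [sq_nonneg e])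
    have c : ‖z‖⁻¹ * (e^2 / (‖z‖^2 + e^2)) ≤ 1 * e^2 :=
      mul_le_mul a b (by positivity) zero_le_one
    have d := mul_le_mul_of_nonneg_left c (abs_nonneg (ω y))
    have : 0 ≤ M * qe e z := by positivity
    linarith

lemma kd_int {ω : E2 → ℝ} (hc : Continuous ω) (hs : HasCompactSupport ω) {e : ℝ} (he : 0 < e)
    (x : E2) : Integrable (fun y => ω y • kd e (x - y)) := by
  have dc := kd_cont he
  exact Continuous.integrable_of_hasCompactSupport (by fun_prop) hs.smul_right

lemma psi_deriv {ω : E2 → ℝ} (hc : Continuous ω) (hs : HasCompactSupport ω) (x : E2) :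
    HasFDerivAt (fun x => ∫ y, Real.log ‖x - y‖ * ω y)
      (innerSL ℝ (∫ y, (ω y / ‖x - y‖ ^ 2) • (x - y))) x := by
  obtain ⟨M, hM0, hM⟩ := om_bound hc hs
  have hoi := hc.integrable_of_hasCompactSupport (μ := volume) hs
  set e : ℕ → ℝ := fun n => 1 / ((n:ℝ) + 1) with hedef
  have he : ∀ n, 0 < e n := fun n => by simp only [hedef]; positivity
  have he1 : ∀ n, e n ≤ 1 := fun n => by
    simp only [hedef]; apply div_le_one_of_le₀ <;> [simp; positivity]
  have h0 : Tendsto e atTop (𝓝 0) := tendsto_one_div_add_atTop_nhds_zero_nat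
  refine hasFDerivAt_of_tendstoUniformly (l := atTop)
    (f := fun n x => ∫ y, kf (e n) (x - y) * ω y)
    (f' := fun n x => innerSL ℝ (∫ y, ω y • kd (e n) (x - y)))
    (g' := fun x => innerSL ℝ (∫ y, (ω y / ‖x - y‖ ^ 2) • (x - y))) ?_ ?_ ?_ x
  · have hB : Tendsto (fun n => (e n)^2 * (∫ y, |ω y|) + M * ∫ z, qe (e n) z) atTop (𝓝 0) := by
      have := ((h0.pow 2).mul_const (∫ y, |ω y|)).add ((qe_tendsto h0).const_mul M)
      simpa using this
    rw [Metric.tendstoUniformly_iff]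
    intro δ hδ
    filter_upwards [hB.eventually (gt_mem_nhds hδ)] with n hn x
    refine lt_of_le_of_lt ?_ hn
    rw [dist_eq_norm, ← map_sub, innerSL_apply_norm, ← integral_sub (vint hc hs x) (kd_int hc hs (he n) x)]
    have hq : Integrable (fun y => qe (e n) (x - y)) := (qe_integrable (e n)).comp_sub_left x
    refine (norm_integral_le_of_norm_le ((hoi.abs.const_mul ((e n)^2)).add (hq.const_mul M))
      (Eventually.of_forall fun y => diff_bound hM (he n) x y)).trans ?_
    simp only [Pi.add_apply]
    rw [integral_add (hoi.abs.const_mul ((e n)^2)) (hq.const_mul M), integral_const_mul,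
      integral_const_mul, integral_sub_left_eq_self (qe (e n)) volume x]
  · intro n x
    refine (reg_deriv hc hs (he n) x).congr_fderiv ?_
    rw [← ContinuousLinearMap.integral_comp_comm (innerSL ℝ) (kd_int hc hs (he n) x)]
    simp
  · intro x
    refine tendsto_integral_of_dominated_convergence
      (fun y => |Real.log ‖x - y‖ * ω y| + |kf 1 (x - y) * ω y|) ?_ ?_ ?_ ?_
    · intro n
      have := kf_cont (he n)
      exact Continuous.aestronglyMeasurable (by fun_prop)
    · refine (logint hc hs x).abs.add (Integrable.abs ?_)
      have := kf_cont one_pos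
      exact Continuous.integrable_of_hasCompactSupport (by fun_prop) hs.mul_left
    · intro n
      have : ∀ᵐ y : E2, y ≠ x := by simp [ae_iff]
      filter_upwards [this] with y hy
      have hz : 0 < ‖x - y‖ := norm_pos_iff.2 (sub_ne_zero.2 hy.symm)
      rw [norm_mul, abs_mul, abs_mul, ← add_mul, Real.norm_eq_abs, Real.norm_eq_abs]
      refine mul_le_mul_of_nonneg_right ?_ (abs_nonneg _)
      have a : Real.log ‖x - y‖ ≤ kf (e n) (x - y) := by
        have : Real.log ‖x - y‖ = (1/2) * Real.log (‖x - y‖^2) := by rw [Real.log_pow]; push_cast; ring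
        rw [this]; unfold kf
        have := Real.log_le_log (by positivity : 0 < ‖x - y‖^2)
          (by nlinarith [sq_nonneg (e n)] : ‖x - y‖^2 ≤ ‖x - y‖^2 + (e n)^2)
        linarith
      have b : kf (e n) (x - y) ≤ kf 1 (x - y) := by
        unfold kf
        have := Real.log_le_log (by positivity : 0 < ‖x - y‖^2 + (e n)^2)
          (by nlinarith [he n, he1 n] : ‖x - y‖^2 + (e n)^2 ≤ ‖x - y‖^2 + 1^2)
        exact mul_le_mul_of_nonneg_left this (by norm_num)
      rw [abs_le]
      constructor
      · linarith [neg_abs_le (Real.log ‖x - y‖), abs_nonneg (kf 1 (x - y))]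
      · linarith [le_abs_self (kf 1 (x - y)), abs_nonneg (Real.log ‖x - y‖)]
    · have : ∀ᵐ y : E2, y ≠ x := by simp [ae_iff]
      filter_upwards [this] with y hy
      have hz : 0 < ‖x - y‖ := norm_pos_iff.2 (sub_ne_zero.2 hy.symm)
      have h1 : Real.log ‖x - y‖ = (1/2) * Real.log (‖x - y‖^2 + 0^2) := by
        rw [zero_pow two_ne_zero, add_zero, Real.log_pow]; push_cast; ring
      rw [h1]
      unfold kf
      refine Tendsto.mul_const _ (Tendsto.const_mul _ (Tendsto.log ?_ (by positivity)))
      exact (h0.pow 2).const_add _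

lemma perp_norm (z : E2) : ‖perp z‖ = ‖z‖ := by
  simp [perp, EuclideanSpace.norm_eq, Fin.sum_univ_two, add_comm]

noncomputable def perpL : E2 →L[ℝ] E2 :=
  LinearMap.toContinuousLinearMap
    { toFun := perp
      map_add' := fun a b => by
        ext i; fin_cases i <;> simp [perp]; ring
      map_smul' := fun c a => by
        ext i; fin_cases i <;> simp [perp] }

lemma perpL_apply (z : E2) : perpL z = perp z := rfl

lemma bs_norm {ω : E2 → ℝ} (hc : Continuous ω) (hs : HasCompactSupport ω) (x : E2) :
    ‖biotSavart2D ω x‖ = (1 / (2 * π)) * ‖∫ y, (ω y / ‖x - y‖ ^ 2) • (x - y)‖ := by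
  unfold biotSavart2D
  have h : (∫ y, (ω y / ‖x - y‖ ^ 2) • perp (x - y))
      = perpL (∫ y, (ω y / ‖x - y‖ ^ 2) • (x - y)) := by
    rw [← ContinuousLinearMap.integral_comp_comm perpL (vint hc hs x)]
    simp only [map_smul, perpL_apply]
  rw [h, perpL_apply, norm_smul, perp_norm, Real.norm_of_nonneg (by positivity)]

lemma bs_bdd {ω : E2 → ℝ} (hc : Continuous ω) (hs : HasCompactSupport ω) :
    BddAbove (Set.range fun y => ‖biotSavart2D ω y‖) := by
  obtain ⟨M, hM0, hM⟩ := om_bound hc hs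
  have hoi := hc.integrable_of_hasCompactSupport (μ := volume) hs
  refine ⟨(1 / (2 * π)) * ((∫ y, |ω y|) + M * ∫ z, qk z), ?_⟩
  rintro _ ⟨x, rfl⟩
  simp only
  rw [bs_norm hc hs]
  refine mul_le_mul_of_nonneg_left ?_ (by positivity)
  refine (norm_integral_le_of_norm_le (dom_integrable hc hs M x)
    (Eventually.of_forall fun y => ?_)).trans ?_
  · rw [norm_kern]; exact inv_mul_le hM x y
  · rw [integral_add hoi.abs ((qk_sub_integrable x).const_mul M), integral_const_mul,
      integral_sub_left_eq_self qk volume x]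

lemma perpGrad_norm_le (f : E2 → ℝ) (x : E2) : ‖perpGrad f x‖ ≤ ‖fderiv ℝ f x‖ := by
  set L := fderiv ℝ f x with hL
  set v : E2 := L (EuclideanSpace.single 0 1) • EuclideanSpace.single 0 1
    + L (EuclideanSpace.single 1 1) • EuclideanSpace.single 1 1 with hv
  have h1 : ‖perpGrad f x‖ = ‖v‖ := by
    simp [perpGrad, EuclideanSpace.norm_eq, Fin.sum_univ_two, hv, ← hL, add_comm]
  have h2 : L v = ‖v‖ ^ 2 := by
    rw [EuclideanSpace.norm_sq_eq, Fin.sum_univ_two]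
    simp [hv]
    ring
  have h3 : ‖v‖ ^ 2 ≤ ‖L‖ * ‖v‖ := by
    rw [← h2]; exact (le_abs_self _).trans (L.le_opNorm v)
  rw [h1]
  by_contra! h
  nlinarith [norm_nonneg v, norm_nonneg L]

lemma stream_deriv {ω : E2 → ℝ} (hc : Continuous ω) (hs : HasCompactSupport ω) (m R : ℝ) (x : E2) :
    DifferentiableAt ℝ (streamR ω m R) x ∧
    ‖fderiv ℝ (streamR ω m R) x‖ = ‖biotSavart2D ω x‖ := by
  have h : HasFDerivAt (streamR ω m R) ((1 / (2 * π)) •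
      innerSL ℝ (∫ y, (ω y / ‖x - y‖ ^ 2) • (x - y))) x :=
    ((psi_deriv hc hs x).const_mul (1 / (2 * π))).sub_const _
  refine ⟨h.differentiableAt, ?_⟩
  rw [h.fderiv, norm_smul, innerSL_apply_norm, bs_norm hc hs, Real.norm_of_nonneg (by positivity)]

lemma abs_log_le {r : ℝ} (h : 1/2 ≤ r) : |Real.log r| ≤ 2 * |r - 1| := by
  have hr : 0 < r := by linarith
  have a := Real.log_le_sub_one_of_pos hr
  have b := Real.log_le_sub_one_of_pos (inv_pos.2 hr)
  rw [Real.log_inv] at b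
  have c : r⁻¹ - 1 ≤ 2 * |r - 1| := by
    have : r⁻¹ - 1 = r⁻¹ * (1 - r) := by field_simp
    rw [this]
    have d : r⁻¹ ≤ 2 := by
      rw [inv_le_comm₀ hr two_pos]; linarith
    calc r⁻¹ * (1 - r) ≤ r⁻¹ * |r - 1| := by
          apply mul_le_mul_of_nonneg_left _ (inv_pos.2 hr).le
          rw [abs_sub_comm]; exact le_abs_self _
      _ ≤ _ := mul_le_mul_of_nonneg_right d (abs_nonneg _)
  rw [abs_le]
  constructor
  · linarith
  · linarith [le_abs_self (r - 1), abs_nonneg (r - 1)]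

lemma stream_bound {ω : E2 → ℝ} (hc : Continuous ω) {R₀ R D : ℝ} (hR₀ : 0 < R₀)
    (hsup : Function.support ω ⊆ Metric.closedBall 0 R₀) (hs : HasCompactSupport ω)
    (hR : 4 * R₀ ≤ R) (hD : D ≤ R / 4) (x : E2) (hx : ‖x‖ < R) (hx2 : R - ‖x‖ ≤ D) :
    |streamR ω (∫ y, ω y) R x| ≤ (D + R₀) * R⁻¹ * ∫ y, |ω y| := by
  have hoi := hc.integrable_of_hasCompactSupport (μ := volume) hs
  have hRp : 0 < R := by linarith
  have h1 : streamR ω (∫ y, ω y) R x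
      = (1 / (2 * π)) * ∫ y, (Real.log ‖x - y‖ * ω y - Real.log R * ω y) := by
    unfold streamR
    rw [integral_sub (logint hc hs x) (hoi.const_mul _), integral_const_mul]
    ring
  have h2 : |∫ y, (Real.log ‖x - y‖ * ω y - Real.log R * ω y)|
      ≤ ∫ y, (2 * ((D + R₀) * R⁻¹)) * |ω y| := by
    rw [← Real.norm_eq_abs]
    refine norm_integral_le_of_norm_le (hoi.abs.const_mul _) (Eventually.of_forall fun y => ?_)
    by_cases hy : ω y = 0
    · simp [hy]
    have hyR : ‖y‖ ≤ R₀ := by simpa using hsup hy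
    have e1 : ‖x‖ - ‖y‖ ≤ ‖x - y‖ := norm_sub_norm_le x y
    have e2 : ‖x - y‖ ≤ ‖x‖ + ‖y‖ := norm_sub_le x y
    have hp : 0 < ‖x - y‖ := by linarith
    rw [← sub_mul, ← Real.log_div hp.ne' hRp.ne', norm_mul, Real.norm_eq_abs, Real.norm_eq_abs]
    refine mul_le_mul_of_nonneg_right ?_ (abs_nonneg _)
    refine (abs_log_le ?_).trans (mul_le_mul_of_nonneg_left ?_ zero_le_two)
    · rw [le_div_iff₀ hRp]; linarith
    · have : ‖x - y‖ / R - 1 = (‖x - y‖ - R) * R⁻¹ := by field_simp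
      rw [this, abs_mul, abs_of_pos (inv_pos.2 hRp)]
      refine mul_le_mul_of_nonneg_right ?_ (inv_pos.2 hRp).le
      rw [abs_le]; constructor <;> linarith
  rw [integral_const_mul] at h2
  rw [h1, abs_mul, abs_of_nonneg (by positivity)]
  have hD0 : 0 ≤ D := by linarith
  have hI : 0 ≤ ∫ y, |ω y| := integral_nonneg fun y => abs_nonneg _
  have h3 : 1 / (2 * π) ≤ 1 / 2 := by
    apply one_div_le_one_div_of_le two_pos
    linarith [Real.pi_gt_three]
  calc _ ≤ 1 / 2 * (2 * ((D + R₀) * R⁻¹) * ∫ y, |ω y|) :=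
        mul_le_mul h3 h2 (abs_nonneg _) (by norm_num)
    _ = _ := by ring

lemma g_deriv_bdd {g : ℝ → ℝ} {δ : ℝ} (hg : ContDiff ℝ (⊤ : ℕ∞) g)
    (hg01 : ∀ t, g t ∈ Set.Icc (0:ℝ) 1)
    (hg0 : ∀ t ≤ (0:ℝ), g t = 0) (hg1 : ∀ t, δ ≤ t → g t = 1) :
    ∃ G, 0 ≤ G ∧ ∀ t, |deriv g t| ≤ G := by
  have hc : Continuous (deriv g) := hg.continuous_deriv (by simp)
  have hs : HasCompactSupport (deriv g) := by
    refine HasCompactSupport.intro (isCompact_Icc (a := 0) (b := δ)) fun t ht => ?_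
    by_cases h : t < 0
    · refine IsLocalMin.deriv_eq_zero (Eventually.of_forall fun s => ?_)
      rw [hg0 t h.le]; exact (hg01 s).1
    · refine IsLocalMax.deriv_eq_zero (Eventually.of_forall fun s => ?_)
      have : δ ≤ t := by
        by_contra! h2
        exact ht ⟨not_lt.1 h, h2.le⟩
      rw [hg1 t this]; exact (hg01 s).2
  obtain ⟨G, hG⟩ := hs.exists_bound_of_continuous hc
  exact ⟨G, (norm_nonneg _).trans (hG 0), hG⟩

lemma cutoff_deriv {g : ℝ → ℝ} {G θ R : ℝ} (hg : Differentiable ℝ g) (hG : ∀ t, |deriv g t| ≤ G)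
    (hR : 0 < R) {x : E2} (hx : x ≠ 0) :
    DifferentiableAt ℝ (cutoff g θ R) x ∧ ‖fderiv ℝ (cutoff g θ R) x‖ ≤ G * R ^ (-θ) := by
  have hn : DifferentiableAt ℝ (fun x : E2 => ‖x‖) x :=
    (differentiableAt_id (𝕜 := ℝ) (x := x)).norm ℝ hx
  have h1 : HasFDerivAt (fun x : E2 => R ^ (-θ) * (R - ‖x‖))
      (R ^ (-θ) • (-(fderiv ℝ (fun x : E2 => ‖x‖) x))) x :=
    (hn.hasFDerivAt.const_sub R).const_mul _
  have h2 : HasFDerivAt (cutoff g θ R) _ x :=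
    (hg (R ^ (-θ) * (R - ‖x‖))).hasDerivAt.comp_hasFDerivAt x h1
  refine ⟨h2.differentiableAt, ?_⟩
  have hp : 0 < R ^ (-θ) := Real.rpow_pos_of_pos hR _
  rw [h2.fderiv, norm_smul, norm_smul, norm_neg, Real.norm_of_nonneg hp.le]
  have h3 : ‖fderiv ℝ (fun x : E2 => ‖x‖) x‖ ≤ 1 := by
    have := norm_fderiv_le_of_lipschitz ℝ (x₀ := x) (lipschitzWith_one_norm (E := E2))
    simpa using this
  refine mul_le_mul (hG _) ?_ (by positivity) ((abs_nonneg _).trans (hG 0))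
  exact mul_le_of_le_one_right hp.le h3

end trunc_helpers

theorem truncation_sup_bound (R₀ θ δ₁ : ℝ) (hR₀ : 0 < R₀)
    (hθ : θ ∈ Set.Icc (0:ℝ) 1) (hδ₁ : δ₁ ∈ Set.Ioc (0:ℝ) (1/2))
    (g : ℝ → ℝ) (hg : ContDiff ℝ (⊤ : ℕ∞) g)
    (hg01 : ∀ t, g t ∈ Set.Icc (0:ℝ) 1)
    (hg0 : ∀ t ≤ (0:ℝ), g t = 0)
    (hg1 : ∀ t, δ₁ / 2 ≤ t → g t = 1) :
    ∃ C > 0, ∀ ω : EuclideanSpace ℝ (Fin 2) → ℝ,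
      Continuous ω →
      Function.support ω ⊆ Metric.closedBall 0 R₀ →
      ∀ R : ℝ, max (4 * R₀) 1 ≤ R →
        ∀ x ∈ Metric.ball (0 : EuclideanSpace ℝ (Fin 2)) R,
          ‖truncate g θ R ω (∫ y, ω y) x‖ ≤
            (⨆ y, ‖biotSavart2D ω y‖) + C * (∫ y, |ω y|) * R⁻¹ := by
  obtain ⟨G, hG0, hG⟩ := g_deriv_bdd hg hg01 hg0 hg1
  refine ⟨G * (1 / 4 + R₀) + 1, by positivity, ?_⟩
  intro ω hc hsup R hR x hx
  have hs : HasCompactSupport ω := by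
    refine HasCompactSupport.intro (isCompact_closedBall (0 : E2) R₀) fun y hy => ?_
    by_contra h
    exact hy (hsup h)
  have hR4 : 4 * R₀ ≤ R := (le_max_left _ _).trans hR
  have hR1 : 1 ≤ R := (le_max_right _ _).trans hR
  have hRp : 0 < R := by linarith
  have hxR : ‖x‖ < R := by simpa using hx
  have hI : 0 ≤ ∫ y, |ω y| := integral_nonneg fun y => abs_nonneg _
  have hu : ‖biotSavart2D ω x‖ ≤ ⨆ y, ‖biotSavart2D ω y‖ := le_ciSup (bs_bdd hc hs) x
  obtain ⟨hd, hdn⟩ := stream_deriv hc hs (∫ y, ω y) R x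
  refine (perpGrad_norm_le _ _).trans ?_
  have hp : 0 < R ^ (-θ) := Real.rpow_pos_of_pos hRp _
  rcases lt_or_ge (δ₁ / 2) (R ^ (-θ) * (R - ‖x‖)) with h | h
  · have hev : (fun x => cutoff g θ R x * streamR ω (∫ y, ω y) R x)
        =ᶠ[nhds x] streamR ω (∫ y, ω y) R := by
      have hcont : Continuous (fun x : E2 => R ^ (-θ) * (R - ‖x‖)) := by fun_prop
      filter_upwards [hcont.continuousAt.eventually (lt_mem_nhds h)] with z hz
      simp [cutoff, hg1 _ hz.le]
    rw [hev.fderiv_eq, hdn]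
    have : 0 ≤ (G * (1 / 4 + R₀) + 1) * (∫ y, |ω y|) * R⁻¹ := by positivity
    linarith
  · have hpp : R ^ θ * R ^ (-θ) = 1 := by
      rw [← Real.rpow_add hRp]; simp
    have hpθ : 0 < R ^ θ := Real.rpow_pos_of_pos hRp _
    have hRθ : R ^ θ ≤ R := by
      simpa using Real.rpow_le_rpow_of_exponent_le hR1 hθ.2
    have hRmθ : R ^ (-θ) ≤ 1 := Real.rpow_le_one_of_one_le_of_nonpos hR1 (by linarith [hθ.1])
    have hlay : R - ‖x‖ ≤ R ^ θ / 4 := by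
      have h1 : R ^ θ * (R ^ (-θ) * (R - ‖x‖)) ≤ R ^ θ * (1 / 4) :=
        mul_le_mul_of_nonneg_left (by linarith [hδ₁.2]) hpθ.le
      rw [← mul_assoc, hpp] at h1
      linarith
    have hx0 : x ≠ 0 := by
      rintro rfl
      simp at hlay
      linarith
    have hsb := stream_bound hc hR₀ hsup hs hR4 (by linarith : R ^ θ / 4 ≤ R / 4) x hxR hlay
    obtain ⟨hcd, hcn⟩ := cutoff_deriv (θ := θ) (hg.differentiable (by simp)) hG hRp hx0
    have hc0 : 0 ≤ cutoff g θ R x := (hg01 _).1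
    have hc1 : cutoff g θ R x ≤ 1 := (hg01 _).2
    rw [fderiv_fun_mul hcd hd]
    refine (norm_add_le _ _).trans ?_
    rw [norm_smul, norm_smul, hdn, Real.norm_of_nonneg hc0, Real.norm_eq_abs]
    refine add_le_add ((mul_le_of_le_one_left (norm_nonneg _) hc1).trans hu) ?_
    calc _ ≤ ((R ^ θ / 4 + R₀) * R⁻¹ * ∫ y, |ω y|) * (G * R ^ (-θ)) :=
          mul_le_mul hsb hcn (norm_nonneg _) (by positivity)
      _ = G * ((R ^ θ * R ^ (-θ)) / 4 + R₀ * R ^ (-θ)) * (∫ y, |ω y|) * R⁻¹ := by ring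
      _ ≤ _ := by
        rw [hpp]
        refine mul_le_mul_of_nonneg_right (mul_le_mul_of_nonneg_right ?_ hI) (by positivity)
        have : G * (1 / 4 + R₀ * R ^ (-θ)) ≤ G * (1 / 4 + R₀) := by
          refine mul_le_mul_of_nonneg_left ?_ hG0
          linarith [mul_le_of_le_one_right hR₀.le hRmθ]
        linarith
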